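/- Let G be an OTG with n vertices and let u and v be nonadjacent vertices of G with d(u) + d(v) ≥ n + 1. Then a nonempty set X ⊆ V(G) is an H-force set of G of minimum cardinality if and only if X is an H-force set of G + uv of minimum cardinality; in particular h(G) = h(G + uv). -/

import Mathlib

open Finset SimpleGraph
open scoped Classical

/-- `X` is a Hamiltonian cycle enforcing set (H-force set) of `G`: `X` is nonempty and
every cycle of `G` containing all vertices of `X` is a Hamiltonian cycle. -/
def IsHForceSet {V : Type*} [Fintype V] [DecidableEq V] (G : SimpleGraph V)
    (X : Finset V) : Prop :=
  X.Nonempty ∧ ∀ (v : V) (c : G.Walk v v), c.IsCycle → (∀ x ∈ X, x ∈ c.support) →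
    c.IsHamiltonianCycle

/-- The H-force number of `G`: the smallest cardinality of an H-force set of `G`. -/
noncomputable def hForce {V : Type*} [Fintype V] [DecidableEq V] (G : SimpleGraph V) : ℕ :=
  sInf {k | ∃ X : Finset V, IsHForceSet G X ∧ X.card = k}

/-- `X` is an H-force set of `G` of minimum cardinality. -/
def IsMinHForceSet {V : Type*} [Fintype V] [DecidableEq V] (G : SimpleGraph V)
    (X : Finset V) : Prop :=
  IsHForceSet G X ∧ ∀ Y : Finset V, IsHForceSet G Y → X.card ≤ Y.card

/-- `G` satisfies the condition of Ore's theorem: `d(u) + d(v) ≥ n` for every pair of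
nonadjacent vertices `u, v`. -/
def IsOTG {V : Type*} [Fintype V] (G : SimpleGraph V) : Prop :=
  ∀ u v : V, u ≠ v → ¬G.Adj u v → Fintype.card V ≤ G.degree u + G.degree v

namespace SimpleGraph.Walk

variable {V : Type*} {G : SimpleGraph V} {u v : V}

/-- Closing up a path of length at least two yields a cycle. -/
lemma IsPath.isCycle_cons {p : G.Walk v u} (hp : p.IsPath) (h : G.Adj u v)
    (hl : 2 ≤ p.length) : (cons h p).IsCycle := by
  refine (cons_isCycle_iff p h).2 ⟨hp, fun hmem => ?_⟩
  have := hp.length_eq_one_of_mem_edges (Sym2.eq_swap ▸ hmem)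
  omega

/-- Ore's crossover: if `u` is adjacent to the successor and `v` to the predecessor end of the
same edge of a `u`-`v` path, then there is a cycle on the vertices of the path. -/
lemma IsPath.exists_isCycle_of_crossing {p : G.Walk u v} (hp : p.IsPath) {i : ℕ}
    (hi : i < p.length) (hl : 2 ≤ p.length) (hu : G.Adj u (p.getVert (i + 1)))
    (hv : G.Adj v (p.getVert i)) :
    ∃ (w : V) (c : G.Walk w w), c.IsCycle ∧ c.length = p.length + 1 ∧
      ∀ x ∈ p.support, x ∈ c.support := by
  let q := (p.drop (i + 1)).append (cons hv (p.take i).reverse)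
  have hlen : q.length = p.length := by
    simp [q]
    omega
  have hmem : ∀ j ≤ p.length, p.getVert j ∈ q.support := by
    intro j hj
    simp only [q, mem_support_append_iff, support_cons, List.mem_cons, support_reverse,
      List.mem_reverse]
    rcases Nat.lt_or_ge i j with hij | hij
    · left
      have : p.getVert j = (p.drop (i + 1)).getVert (j - (i + 1)) := by
        rw [drop_getVert]; congr 1; omega
      rw [this]
      exact getVert_mem_support _ _
    · right; right
      have : p.getVert j = (p.take i).getVert j := by
        rw [take_getVert]; congr 1; omega
      rw [this]
      exact getVert_mem_support _ _
  have hsub : p.support ⊆ q.support := by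
    intro x hx
    obtain ⟨j, rfl, hj⟩ := mem_support_iff_exists_getVert.1 hx
    exact hmem j hj
  have hq : q.IsPath := by
    rw [isPath_def]
    refine ((hp.support_nodup.subperm hsub).perm_of_length_le ?_).nodup hp.support_nodup
    simp [length_support, hlen]
  exact ⟨_, cons hu q, hq.isCycle_cons hu (hlen ▸ hl), by simp [hlen],
    fun x hx => by simp [hsub hx]⟩

/-- If the ends of a path have at least as many neighbours on the path, counted together, as the
path has vertices, then there is a cycle on the vertices of the path. -/
lemma IsPath.exists_isCycle_of_length_lt_card {p : G.Walk u v} (hp : p.IsPath)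
    (hl : 2 ≤ p.length)
    (hcard : p.length < #{x ∈ p.support.toFinset | G.Adj u x} +
      #{x ∈ p.support.toFinset | G.Adj v x}) :
    ∃ (w : V) (c : G.Walk w w), c.IsCycle ∧ c.length = p.length + 1 ∧
      ∀ x ∈ p.support, x ∈ c.support := by
  let A := {i ∈ range p.length | G.Adj u (p.getVert (i + 1))}
  let B := {i ∈ range p.length | G.Adj v (p.getVert i)}
  have hA : #{x ∈ p.support.toFinset | G.Adj u x} ≤ #A := by
    refine (card_le_card fun x hx => ?_).trans
      (card_image_le (s := A) (f := fun i => p.getVert (i + 1)))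
    simp only [mem_filter, List.mem_toFinset, mem_support_iff_exists_getVert] at hx
    obtain ⟨⟨j, rfl, hj⟩, hadj⟩ := hx
    have hj0 : j ≠ 0 := by
      rintro rfl
      simp at hadj
    obtain ⟨i, rfl⟩ := Nat.exists_eq_succ_of_ne_zero hj0
    exact mem_image.2 ⟨i, by simpa [A, hadj] using hj, rfl⟩
  have hB : #{x ∈ p.support.toFinset | G.Adj v x} ≤ #B := by
    refine (card_le_card fun x hx => ?_).trans (card_image_le (s := B) (f := p.getVert))
    simp only [mem_filter, List.mem_toFinset, mem_support_iff_exists_getVert] at hx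
    obtain ⟨⟨j, rfl, hj⟩, hadj⟩ := hx
    have hjl : j ≠ p.length := by
      rintro rfl
      simp at hadj
    exact mem_image.2 ⟨j, by simp [B, hadj]; omega, rfl⟩
  have hne : ¬Disjoint A B := by
    intro hd
    have h := card_le_card (union_subset (filter_subset _ _) (filter_subset _ _) :
      A ∪ B ⊆ range p.length)
    rw [card_union_of_disjoint hd, card_range] at h
    omega
  obtain ⟨i, hiA, hiB⟩ := not_disjoint_iff.1 hne
  simp only [A, B, mem_filter, mem_range] at hiA hiB
  exact hp.exists_isCycle_of_crossing hiA.1 hl hiA.2 hiB.2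

/-- A non-Hamiltonian path whose ends have degree sum greater than the number of vertices can be
covered by a non-Hamiltonian cycle. -/
lemma IsPath.exists_isCycle_length_lt_card [Fintype V] {p : G.Walk u v} (hp : p.IsPath)
    (hl : 2 ≤ p.length) (hlt : p.length + 1 < Fintype.card V)
    (hdeg : Fintype.card V + 1 ≤ G.degree u + G.degree v) :
    ∃ (w : V) (c : G.Walk w w), c.IsCycle ∧ c.length < Fintype.card V ∧
      ∀ x ∈ p.support, x ∈ c.support := by
  rcases Nat.lt_or_ge p.length (#{x ∈ p.support.toFinset | G.Adj u x} +
      #{x ∈ p.support.toFinset | G.Adj v x}) with h | h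
  · obtain ⟨w, c, hc, hcl, hsup⟩ := hp.exists_isCycle_of_length_lt_card hl h
    exact ⟨w, c, hc, hcl ▸ hlt, hsup⟩
  have hsplit (x : V) : G.degree x = #{y ∈ p.support.toFinset | G.Adj x y} +
      #{y ∈ p.support.toFinsetᶜ | G.Adj x y} := by
    rw [← card_neighborFinset_eq_degree, neighborFinset_eq_filter,
      ← card_union_of_disjoint (disjoint_filter_filter disjoint_compl_right), ← filter_union,
      union_compl]
  have hcompl : #p.support.toFinsetᶜ = Fintype.card V - (p.length + 1) := by
    rw [card_compl, List.toFinset_card_of_nodup hp.support_nodup, length_support]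
  let A := {y ∈ p.support.toFinsetᶜ | G.Adj u y}
  let B := {y ∈ p.support.toFinsetᶜ | G.Adj v y}
  have hA : #A ≤ #p.support.toFinsetᶜ := card_filter_le _ _
  have hB : #B ≤ #p.support.toFinsetᶜ := card_filter_le _ _
  have hu : G.degree u = _ + #A := hsplit u
  have hv : G.degree v = _ + #B := hsplit v
  have hne : ¬Disjoint A B := by
    intro hd
    have h := card_le_card (union_subset (filter_subset _ _) (filter_subset _ _) :
      A ∪ B ⊆ p.support.toFinsetᶜ)
    rw [card_union_of_disjoint hd] at h
    omega
  obtain ⟨w, hwA, hwB⟩ := not_disjoint_iff.1 hne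
  simp only [A, B, mem_filter, mem_compl, List.mem_toFinset] at hwA hwB
  refine ⟨w, cons hwA.2.symm (p.concat hwB.2), (hp.concat hwA.1 hwB.2).isCycle_cons _ ?_, ?_, ?_⟩
  · simp; omega
  · simp only [length_cons, length_concat]
    omega
  · intro x hx
    simp [support_concat, hx]

/-- A walk of `G + uv` that avoids the new edge uses only edges of `G`. -/
lemma mem_edgeSet_of_edge_notMem_edges {a b : V} (p : (G ⊔ edge u v).Walk a b)
    (hp : s(u, v) ∉ p.edges) : ∀ e ∈ p.edges, e ∈ G.edgeSet := by
  intro e he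
  have hmem := p.edges_subset_edgeSet he
  induction e with
  | _ x y =>
    rw [SimpleGraph.mem_edgeSet, sup_adj, edge_adj] at hmem
    rcases hmem with h | ⟨⟨rfl, rfl⟩ | ⟨rfl, rfl⟩, -⟩
    · exact h
    · exact absurd he hp
    · exact absurd (Sym2.eq_swap ▸ he) hp

/-- A cycle of `G + uv` leaving `u` along the new edge comes from a `u`-`v` path of `G`. -/
lemma IsCycle.exists_isPath_of_snd_eq {c : (G ⊔ edge u v).Walk u u} (hc : c.IsCycle)
    (hsnd : c.snd = v) :
    ∃ p : G.Walk u v, p.IsPath ∧ p.length + 1 = c.length ∧ c.support ⊆ p.support := by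
  cases c with
  | nil => exact absurd hc not_isCycle_nil
  | cons h q =>
    obtain rfl : _ = v := by simpa using hsnd
    obtain ⟨hq, he⟩ := (cons_isCycle_iff q h).1 hc
    have hG : ∀ e ∈ q.reverse.edges, e ∈ G.edgeSet :=
      q.reverse.mem_edgeSet_of_edge_notMem_edges (by simpa using he)
    refine ⟨q.reverse.transfer G hG, hq.reverse.transfer hG, by simp, fun x hx => ?_⟩
    simp only [support_cons, List.mem_cons] at hx
    simp only [support_transfer, support_reverse, List.mem_reverse]
    rcases hx with rfl | hx
    · exact q.end_mem_support
    · exact hx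

/-- Removing the new edge from a cycle of `G + uv` containing it leaves a `u`-`v` path of `G`. -/
lemma IsCycle.exists_isPath_of_mem_edges {w : V} {c : (G ⊔ edge u v).Walk w w} (hc : c.IsCycle)
    (he : s(u, v) ∈ c.edges) :
    ∃ p : G.Walk u v, p.IsPath ∧ p.length + 1 = c.length ∧ c.support ⊆ p.support := by
  have hu : u ∈ c.support := c.fst_mem_support_of_mem_edges he
  have hc' : (c.rotate u hu).IsCycle := (isCycle_rotate hu).2 hc
  have he' : s(u, v) ∈ (c.rotate u hu).edges := (c.rotate_edges u hu).mem_iff.2 he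
  have hlen : (c.rotate u hu).length = c.length := c.length_rotate u hu
  have hsupp : c.support ⊆ (c.rotate u hu).support := fun x hx =>
    (c.mem_support_rotate_iff u hu).2 hx
  generalize c.rotate u hu = d at *
  suffices h : d.snd = v ∨ d.reverse.snd = v by
    rcases h with h | h
    · obtain ⟨p, hp, hl, hs⟩ := hc'.exists_isPath_of_snd_eq h
      exact ⟨p, hp, hl.trans hlen, fun x hx => hs (hsupp hx)⟩
    · obtain ⟨p, hp, hl, hs⟩ := hc'.reverse.exists_isPath_of_snd_eq h
      refine ⟨p, hp, by simpa [hlen] using hl, fun x hx => hs ?_⟩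
      simpa using hsupp hx
  rw [snd_reverse]
  cases d with
  | nil => exact absurd hc' not_isCycle_nil
  | cons h q =>
    obtain ⟨hq, -⟩ := (cons_isCycle_iff q h).1 hc'
    have hnil : ¬q.Nil := by
      intro hn
      exact h.ne hn.eq.symm
    rw [snd_cons, penultimate_cons_of_not_nil _ _ hnil]
    rw [edges_cons, List.mem_cons] at he'
    rcases he' with he' | he'
    · left
      exact (Sym2.congr_right.1 he').symm
    · right
      exact (hq.eq_penultimate_of_mem_edges (Sym2.eq_swap ▸ he')).symm

end SimpleGraph.Walk

/-- Joining two nonadjacent vertices with degree sum greater than the number of vertices does not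
change the H-force sets. -/
lemma isHForceSet_sup_edge_iff {V : Type*} [Fintype V] [DecidableEq V] (G : SimpleGraph V)
    (u v : V) (hdeg : Fintype.card V + 1 ≤ G.degree u + G.degree v) (X : Finset V) :
    IsHForceSet (G ⊔ SimpleGraph.edge u v) X ↔ IsHForceSet G X := by
  refine and_congr_right fun _ => ⟨fun h w c hc hX => ?_, fun h w c hc hX => ?_⟩
  · have := h w (c.mapLe le_sup_left) (hc.mapLe le_sup_left) (by simpa using hX)
    rw [Walk.isHamiltonianCycle_iff_isCycle_and_length_eq] at this ⊢
    exact ⟨hc, by simpa using this.2⟩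
  · rw [Walk.isHamiltonianCycle_iff_isCycle_and_length_eq]
    refine ⟨hc, ?_⟩
    by_cases he : s(u, v) ∈ c.edges
    · obtain ⟨p, hp, hl, hs⟩ := hc.exists_isPath_of_mem_edges he
      have hle : p.length < Fintype.card V := hp.length_lt
      have h3 := hc.three_le_length
      by_contra hne
      obtain ⟨x, d, hd, hdl, hds⟩ :=
        hp.exists_isCycle_length_lt_card (by omega) (by omega) hdeg
      exact hdl.ne (h x d hd fun y hy => hds y (hs (hX y hy))).length_eq
    · have hG := c.mem_edgeSet_of_edge_notMem_edges he
      simpa using (h w (c.transfer G hG) (hc.transfer hG) (by simpa using hX)).length_eq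

/-- If `u, v` are nonadjacent vertices of an OTG `G` with `d(u) + d(v) ≥ n + 1`, then a nonempty
set `X` is a minimum H-force set of `G` iff it is a minimum H-force set of `G + uv`;
in particular `h(G) = h(G + uv)`. -/
theorem stmt_4 {V : Type*} [Fintype V] [DecidableEq V] (G : SimpleGraph V)
    (hOTG : IsOTG G) (u v : V) (huv : u ≠ v) (hadj : ¬G.Adj u v)
    (hdeg : Fintype.card V + 1 ≤ G.degree u + G.degree v) :
    (∀ X : Finset V, X.Nonempty →
      (IsMinHForceSet G X ↔ IsMinHForceSet (G ⊔ SimpleGraph.edge u v) X)) ∧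
    hForce G = hForce (G ⊔ SimpleGraph.edge u v) := by
  have h := isHForceSet_sup_edge_iff G u v hdeg
  simp only [IsMinHForceSet, hForce, h, implies_true, and_self]
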